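/- Let q be a prime power and 1 ≤ r < n ≤ m. Then A_R(q,m,n,r+1,r) = [n r]_q and A_C(q,n,r,1) = [n r]_q; in particular A_R(q,m,n,r+1,r) = A_C(q,n,r,1). -/

import Mathlib

open Module

noncomputable def injDist {F V : Type*} [Field F] [AddCommGroup V] [Module F V]
    (U W : Submodule F V) : ℕ :=
  finrank F ↥(U ⊔ W) - min (finrank F ↥U) (finrank F ↥W)

def rowSpace {F : Type*} [CommRing F] {m n : ℕ} (X : Matrix (Fin m) (Fin n) F) :
    Submodule F (Fin n → F) :=
  LinearMap.range X.vecMulLinear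

def colSpace {F : Type*} [CommRing F] {m n : ℕ} (X : Matrix (Fin m) (Fin n) F) :
    Submodule F (Fin m → F) :=
  LinearMap.range X.mulVecLin

noncomputable def minRankDist {F : Type*} [Field F] {m n : ℕ}
    (C : Set (Matrix (Fin m) (Fin n) F)) : ℕ :=
  sInf {e | ∃ X ∈ C, ∃ Y ∈ C, X ≠ Y ∧ (X - Y).rank = e}

noncomputable def minInjDist {F V : Type*} [Field F] [AddCommGroup V] [Module F V]
    (S : Set (Submodule F V)) : ℕ :=
  sInf {e | ∃ U ∈ S, ∃ W ∈ S, U ≠ W ∧ injDist U W = e}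

/-- Maximum cardinality of a nonempty code of `m × n` matrices whose ranks all lie in `I`
and in which any two distinct codewords are at rank distance at least `d`. -/
noncomputable def maxRankCode (F : Type*) [Field F] [Fintype F] (m n d : ℕ) (I : Set ℕ) : ℕ :=
  sSup {c : ℕ | ∃ C : Set (Matrix (Fin m) (Fin n) F), C.Nonempty ∧
    (∀ X ∈ C, X.rank ∈ I) ∧
    (∀ X ∈ C, ∀ Y ∈ C, X ≠ Y → d ≤ (X - Y).rank) ∧ C.ncard = c}

/-- `A_R(q,m,n,d,r)` : maximum cardinality of a constant-rank code of constant rank `r`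
and minimum rank distance at least `d` in `GF(q)^{m × n}`. -/
noncomputable def A_R (F : Type*) [Field F] [Fintype F] (m n d r : ℕ) : ℕ :=
  maxRankCode F m n d {r}

/-- `A_C(q,n,r,d)` : maximum cardinality of a constant-dimension code of dimension `r`
and minimum injection distance at least `d` in `GF(q)^n`. -/
noncomputable def A_C (F : Type*) [Field F] [Fintype F] (n r d : ℕ) : ℕ :=
  sSup {c : ℕ | ∃ S : Set (Submodule F (Fin n → F)), S.Nonempty ∧
    (∀ U ∈ S, finrank F ↥U = r) ∧
    (∀ U ∈ S, ∀ V ∈ S, U ≠ V → d ≤ injDist U V) ∧ S.ncard = c}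

/-- `N_R(q,m,n,r)` : number of `m × n` matrices over `GF(q)` of rank `r`. -/
noncomputable def N_R (F : Type*) [Field F] [Fintype F] (m n r : ℕ) : ℕ :=
  Nat.card {X : Matrix (Fin m) (Fin n) F // X.rank = r}

/-- `α(m,s) = ∏_{i=0}^{s-1} (q^m - q^i)`. -/
def alphaq (q m s : ℕ) : ℕ := ∏ i ∈ Finset.range s, (q ^ m - q ^ i)

/-- The Gaussian binomial `[n r]_q = α(n,r) / α(r,r)`. -/
def gaussBinom (q n r : ℕ) : ℕ := alphaq q n r / alphaq q r r

/-- `K_q = ∏_{j=1}^∞ (1 - q^{-j})`. -/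
noncomputable def Kq (q : ℕ) : ℝ := ∏' j : ℕ, (1 - ((q : ℝ))⁻¹ ^ (j + 1))

/-- `M(q,m,n,d,r)` : the number of codewords of rank `r` in an `(n, n-d+1, d)` linear MRD
code over `GF(q^m)`. -/
def Mcount (q m n d r : ℕ) : ℤ :=
  (gaussBinom q n r : ℤ) *
    ∑ j ∈ Finset.Icc d r, (-1 : ℤ) ^ (r - j) * (gaussBinom q r j : ℤ) *
      (q : ℤ) ^ ((r - j) * (r - j - 1) / 2) * ((q : ℤ) ^ (m * (j - d + 1)) - 1)

open Polynomial in
/-- The linearized polynomial map with coefficients `a`. -/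
noncomputable def linPoly (F L : Type*) [Field F] [Fintype F] [Field L] [Algebra F L] {k : ℕ}
    (a : Fin k → L) : L →ₗ[F] L :=
  ∑ i, a i • (FiniteField.frobeniusAlgHom F L ^ (i : ℕ)).toLinearMap

lemma frob_pow_apply (F L : Type*) [Field F] [Fintype F] [Field L] [Algebra F L] (i : ℕ) (x : L) :
    (FiniteField.frobeniusAlgHom F L ^ i) x = x ^ (Fintype.card F ^ i) := by
  rw [AlgHom.coe_pow, FiniteField.coe_frobeniusAlgHom, pow_iterate]

lemma linPoly_apply (F L : Type*) [Field F] [Fintype F] [Field L] [Algebra F L] {k : ℕ}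
    (a : Fin k → L) (x : L) :
    linPoly F L a x = ∑ i, a i * x ^ (Fintype.card F ^ (i : ℕ)) := by
  simp [linPoly, LinearMap.sum_apply, frob_pow_apply]

open Polynomial in
lemma finrank_ker_linPoly_lt (F L : Type*) [Field F] [Fintype F] [Field L] [Algebra F L]
    [Finite L] {k : ℕ} (a : Fin k → L) (ha : a ≠ 0) :
    finrank F (LinearMap.ker (linPoly F L a)) < k := by
  classical
  have hq : 1 < Fintype.card F := Fintype.one_lt_card
  have := Fintype.ofFinite L
  let p : L[X] := ∑ i, C (a i) * X ^ (Fintype.card F ^ (i : ℕ))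
  have hcoef : ∀ j : Fin k, p.coeff (Fintype.card F ^ (j : ℕ)) = a j := by
    intro j
    simp only [p, finsetSum_coeff, coeff_C_mul, coeff_X_pow]
    rw [Finset.sum_eq_single j]
    · simp
    · intro b _ hb
      have : Fintype.card F ^ (j : ℕ) ≠ Fintype.card F ^ (b : ℕ) := by
        intro h
        exact hb (Fin.ext (Nat.pow_right_injective hq h).symm)
      simp [this]
    · simp
  have hp : p ≠ 0 := by
    intro h
    apply ha
    funext j
    rw [← hcoef j, h]; simp
  have hk : 0 < k := by
    rcases Nat.eq_zero_or_pos k with rfl | h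
    · exact absurd (Subsingleton.elim a 0) ha
    · exact h
  have hdeg : p.natDegree ≤ Fintype.card F ^ (k - 1) := by
    apply natDegree_sum_le_of_forall_le
    intro i _
    refine (natDegree_C_mul_X_pow_le _ _).trans ?_
    exact Nat.pow_le_pow_right (by omega) (by omega)
  have hroots : ((Finset.univ.filter (fun x : L => x ∈ LinearMap.ker (linPoly F L a)))).val
      ⊆ p.roots := by
    intro x hx
    have hx : x ∈ LinearMap.ker (linPoly F L a) := by simpa using hx
    rw [mem_roots hp, IsRoot.def]
    rw [LinearMap.mem_ker, linPoly_apply] at hx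
    simp only [p, eval_finsetSum, eval_mul, eval_C, eval_pow, eval_X]
    exact hx
  have h1 := card_le_degree_of_subset_roots hroots
  have h2 : (Finset.univ.filter (fun x : L => x ∈ LinearMap.ker (linPoly F L a))).card
      = Fintype.card F ^ finrank F (LinearMap.ker (linPoly F L a)) := by
    rw [← Module.card_eq_pow_finrank (K := F), Fintype.card_subtype]
  have h3 : Fintype.card F ^ finrank F (LinearMap.ker (linPoly F L a))
      ≤ Fintype.card F ^ (k - 1) := by
    rw [← h2]; exact h1.trans hdeg
  have := (Nat.pow_le_pow_iff_right hq).1 h3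
  omega

lemma linPoly_sub (F L : Type*) [Field F] [Fintype F] [Field L] [Algebra F L] {k : ℕ}
    (a b : Fin k → L) : linPoly F L (a - b) = linPoly F L a - linPoly F L b := by
  ext x
  simp [linPoly_apply, sub_mul]

lemma exists_monic_linPoly (F L : Type*) [Field F] [Fintype F] [Field L] [Algebra F L]
    [Finite L] {k : ℕ} (K : Submodule F L) (hK : finrank F K = k) :
    ∃ g : Fin k → L, LinearMap.ker
      ((FiniteField.frobeniusAlgHom F L ^ k).toLinearMap - linPoly F L g) = K := by
  have : Module.Finite F L := Module.Finite.of_finite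
  let b := finBasisOfFinrankEq F K hK
  let E : (Fin k → L) →ₗ[L] (Fin k → L) :=
    { toFun := fun g i => linPoly F L g (b i)
      map_add' := by
        intro x y; funext i
        simp [linPoly_apply, add_mul, Finset.sum_add_distrib]
      map_smul' := by
        intro c y; funext i
        simp [linPoly_apply, mul_assoc, Finset.mul_sum] }
  have key : ∀ f : L →ₗ[F] L, (∀ i, f (b i) = 0) → K ≤ LinearMap.ker f := by
    intro f hf x hx
    have h0 : f.comp K.subtype = 0 := b.ext (by intro i; simpa using hf i)
    have := LinearMap.congr_fun h0 ⟨x, hx⟩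
    simpa using this
  have hinj : Function.Injective E := by
    rw [injective_iff_map_eq_zero]
    intro g hg
    by_contra hne
    have h1 := finrank_ker_linPoly_lt F L g hne
    have h2 := Submodule.finrank_mono (key (linPoly F L g) (fun i => congrFun hg i))
    omega
  obtain ⟨g, hg⟩ := (LinearMap.injective_iff_surjective.1 hinj)
    (fun i => (b i : L) ^ (Fintype.card F ^ k))
  refine ⟨g, ?_⟩
  symm
  apply Submodule.eq_of_le_of_finrank_le
  · apply key
    intro i
    have := congrFun hg i
    have h' : linPoly F L g (b i) = (b i : L) ^ (Fintype.card F ^ k) := this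
    simp [h', frob_pow_apply]
  · have hf : (FiniteField.frobeniusAlgHom F L ^ k).toLinearMap - linPoly F L g
        = linPoly F L (Fin.snoc (α := fun _ => L) (-g) 1 : Fin (k + 1) → L) := by
      ext x
      simp [linPoly_apply, Fin.sum_univ_castSucc, frob_pow_apply]
      ring
    rw [hf]
    have hne : (Fin.snoc (α := fun _ => L) (-g) 1 : Fin (k + 1) → L) ≠ 0 := by
      intro h
      have := congrFun h (Fin.last k)
      simp at this
    have := finrank_ker_linPoly_lt F L _ hne
    omega

lemma exists_ext (F : Type*) [Field F] [Fintype F] (m : ℕ) (hm : 0 < m) :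
    ∃ (L : Type) (_ : Field L) (_ : Algebra F L), Finite L ∧ finrank F L = m := by
  obtain ⟨p, hp⟩ := CharP.exists F
  have : Fact p.Prime := ⟨CharP.char_is_prime F p⟩
  have : NeZero m := ⟨hm.ne'⟩
  refine ⟨FiniteField.Extension F p m, inferInstance, inferInstance, ?_,
    FiniteField.finrank_extension F p m⟩
  exact Module.finite_of_finite F

lemma exists_code (F : Type*) [Field F] [Fintype F] {m n k : ℕ} (hn : 0 < n) (hnm : n ≤ m) :
    ∃ f : {K : Submodule F (Fin n → F) // finrank F K = k} →
        ((Fin n → F) →ₗ[F] (Fin m → F)),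
      (∀ K, LinearMap.ker (f K) = K.1) ∧
      ∀ K K', K ≠ K' → finrank F (LinearMap.ker (f K - f K')) < k := by
  obtain ⟨L, _, _, hL, hm⟩ := exists_ext F m (by omega)
  have : Module.Finite F L := Module.Finite.of_finite
  let e : L ≃ₗ[F] (Fin m → F) := LinearEquiv.ofFinrankEq _ _ (by simp [hm])
  let ι : (Fin n → F) →ₗ[F] L :=
    e.symm.toLinearMap.comp (Function.ExtendByZero.linearMap F (Fin.castLE hnm))
  have hι : Function.Injective ι := by
    refine e.symm.injective.comp ?_
    intro x y h
    funext i
    have := congrFun h (Fin.castLE hnm i)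
    simpa [(Fin.castLE_injective hnm).extend_apply] using this
  have hfr : ∀ K : Submodule F (Fin n → F), finrank F (K.map ι) = finrank F K :=
    fun K => (Submodule.equivMapOfInjective ι hι K).finrank_eq.symm
  choose g hg using fun K : {K : Submodule F (Fin n → F) // finrank F K = k} =>
    exists_monic_linPoly F L (k := k) (K.1.map ι) (by rw [hfr, K.2])
  have hker : ∀ K, LinearMap.ker (e.toLinearMap.comp
      (((FiniteField.frobeniusAlgHom F L ^ k).toLinearMap - linPoly F L (g K)).comp ι)) = K.1 := by
    intro K
    rw [LinearEquiv.ker_comp, LinearMap.ker_comp, hg, Submodule.comap_map_eq_of_injective hι]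
  refine ⟨fun K => e.toLinearMap.comp
      (((FiniteField.frobeniusAlgHom F L ^ k).toLinearMap - linPoly F L (g K)).comp ι), hker, ?_⟩
  intro K K' hne
  have hgne : g K' - g K ≠ 0 := by
    intro h
    apply hne
    apply Subtype.ext
    rw [← hker K, ← hker K', sub_eq_zero.1 h]
  have heq : e.toLinearMap.comp
      (((FiniteField.frobeniusAlgHom F L ^ k).toLinearMap - linPoly F L (g K)).comp ι)
      - e.toLinearMap.comp
      (((FiniteField.frobeniusAlgHom F L ^ k).toLinearMap - linPoly F L (g K')).comp ι)
      = e.toLinearMap.comp ((linPoly F L (g K' - g K)).comp ι) := by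
    rw [linPoly_sub, ← LinearMap.comp_sub, ← LinearMap.sub_comp]
    congr 2
    abel
  rw [heq, LinearEquiv.ker_comp, LinearMap.ker_comp, ← hfr]
  exact (Submodule.finrank_mono (Submodule.map_comap_le _ _)).trans_lt
    (finrank_ker_linPoly_lt F L _ hgne)

lemma card_grass (F V : Type*) [Field F] [Fintype F] [AddCommGroup V] [Module F V]
    [Finite V] (r : ℕ) (hr : r ≤ finrank F V) :
    Nat.card {U : Submodule F V // finrank F U = r}
      = gaussBinom (Fintype.card F) (finrank F V) r := by
  have : Module.Finite F V := Module.Finite.of_finite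
  have hq : 1 < Fintype.card F := Fintype.one_lt_card
  have aux : ∀ x y : (Σ U : {U : Submodule F V // finrank F U = r},
        {s : Fin r → U.1 // LinearIndependent F s}), x.1.1 = y.1.1 →
        (∀ i, (x.2.1 i : V) = y.2.1 i) → x = y := by
    rintro ⟨⟨U, hU⟩, s, hs⟩ ⟨⟨U', hU'⟩, s', hs'⟩ h1 h2
    dsimp only at h1
    subst h1
    have : s = s' := funext (fun i => Subtype.ext (h2 i))
    subst this
    rfl
  let e : {s : Fin r → V // LinearIndependent F s} ≃
      Σ U : {U : Submodule F V // finrank F U = r},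
        {s : Fin r → U.1 // LinearIndependent F s} :=
    { toFun := fun s => ⟨⟨Submodule.span F (Set.range s.1), by
          rw [finrank_span_eq_card s.2, Fintype.card_fin]⟩,
        ⟨fun i => ⟨s.1 i, Submodule.subset_span ⟨i, rfl⟩⟩, by
          apply LinearIndependent.of_comp (Submodule.subtype _)
          exact s.2⟩⟩
      invFun := fun x => ⟨fun i => (x.2.1 i : V),
        x.2.2.map' (Submodule.subtype _) (Submodule.ker_subtype _)⟩
      left_inv := fun s => rfl
      right_inv := by
        rintro ⟨⟨U, hU⟩, ⟨s, hs⟩⟩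
        have hspan : Submodule.span F (Set.range (fun i => (s i : V))) = U := by
          apply Submodule.eq_of_le_of_finrank_eq
          · rw [Submodule.span_le]
            rintro _ ⟨i, rfl⟩
            exact (s i).2
          · have h := finrank_span_eq_card
              (hs.map' (Submodule.subtype _) (Submodule.ker_subtype _))
            rw [Fintype.card_fin] at h
            exact h.trans hU.symm
        exact aux _ _ hspan (fun i => rfl) }
  have h1 := Nat.card_congr e
  rw [card_linearIndependent hr] at h1
  have := Fintype.ofFinite {U : Submodule F V // finrank F U = r}
  rw [Nat.card_sigma] at h1
  have h2 : ∀ U : {U : Submodule F V // finrank F U = r},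
      Nat.card {s : Fin r → U.1 // LinearIndependent F s} = alphaq (Fintype.card F) r r := by
    intro U
    rw [card_linearIndependent U.2.ge, U.2, alphaq, Finset.prod_range]
  rw [Finset.sum_congr rfl (fun U _ => h2 U), Finset.sum_const, Finset.card_univ, smul_eq_mul] at h1
  have hpos : 0 < alphaq (Fintype.card F) r r := by
    apply Finset.prod_pos
    intro i hi
    exact Nat.sub_pos_of_lt (Nat.pow_lt_pow_right hq (Finset.mem_range.1 hi))
  rw [gaussBinom, alphaq, Finset.prod_range, h1, Nat.mul_div_cancel _ hpos,
    Nat.card_eq_fintype_card]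

lemma card_grass_compl (F : Type*) [Field F] [Fintype F] (n r : ℕ) (hr : r ≤ n) :
    Nat.card {U : Submodule F (Fin n → F) // finrank F U = n - r}
      = gaussBinom (Fintype.card F) n r := by
  have hn : finrank F (Dual F (Fin n → F)) = n := by simp
  have : Finite (Dual F (Fin n → F)) := Module.finite_of_finite F
  have h := card_grass F (Dual F (Fin n → F)) r (by omega)
  rw [hn] at h
  rw [← h]
  refine Nat.card_congr (Equiv.subtypeEquiv
    ((Subspace.orderIsoFiniteDimensional (K := F) (V := Fin n → F)).toEquiv.trans
      OrderDual.ofDual) ?_)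
  intro U
  have := Subspace.finrank_add_finrank_dualAnnihilator_eq U
  rw [Module.finrank_fin_fun] at this
  change _ ↔ finrank F U.dualAnnihilator = r
  omega

lemma rank_add_ker (F : Type*) [Field F] {m n : ℕ} (X : Matrix (Fin m) (Fin n) F) :
    X.rank + finrank F (LinearMap.ker X.mulVecLin) = n := by
  have := LinearMap.finrank_range_add_finrank_ker X.mulVecLin
  rwa [Module.finrank_fin_fun] at this

lemma exists_sub (F : Type*) [Field F] (n r : ℕ) (h : r ≤ n) :
    ∃ U : Submodule F (Fin n → F), finrank F U = r := by
  refine ⟨Submodule.span F (Set.range (fun i => Pi.basisFun F (Fin n) (Fin.castLE h i))), ?_⟩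
  have := finrank_span_eq_card
    ((Pi.basisFun F (Fin n)).linearIndependent.comp _ (Fin.castLE_injective h))
  rw [Fintype.card_fin] at this
  exact this

theorem stmt19 {q m n r : ℕ} (F : Type*) [Field F] [Fintype F] (hF : Fintype.card F = q)
    (hr1 : 1 ≤ r) (hrn : r < n) (hnm : n ≤ m) :
    A_R F m n (r + 1) r = gaussBinom q n r ∧ A_C F n r 1 = gaussBinom q n r := by
  subst hF
  constructor
  · have hcard := card_grass_compl F n r hrn.le
    apply IsGreatest.csSup_eq
    constructor
    · obtain ⟨f, hf, hd⟩ := exists_code F (k := n - r) (by omega : 0 < n) hnm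
      have hmv : ∀ g : (Fin n → F) →ₗ[F] (Fin m → F),
          (LinearMap.toMatrix' g).mulVecLin = g := by
        intro g
        rw [← Matrix.toLin'_apply', Matrix.toLin'_toMatrix']
      have hinj : Function.Injective (fun K => LinearMap.toMatrix' (f K)) := by
        intro K K' h
        have h' := LinearMap.toMatrix'.injective h
        apply Subtype.ext
        rw [← hf K, ← hf K', h']
      refine ⟨Set.range (fun K => LinearMap.toMatrix' (f K)), ?_, ?_, ?_, ?_⟩
      · obtain ⟨U, hU⟩ := exists_sub F n (n - r) (by omega)
        exact ⟨_, ⟨⟨U, hU⟩, rfl⟩⟩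
      · rintro _ ⟨K, rfl⟩
        have := rank_add_ker F (LinearMap.toMatrix' (f K))
        rw [hmv, hf, K.2] at this
        simp only [Set.mem_singleton_iff]
        omega
      · rintro _ ⟨K, rfl⟩ _ ⟨K', rfl⟩ hne
        have h1 := hd K K' (fun h => hne (by rw [h]))
        have := rank_add_ker F (LinearMap.toMatrix' (f K) - LinearMap.toMatrix' (f K'))
        rw [← map_sub, hmv] at this
        simp only [← map_sub]
        omega
      · rw [← Set.image_univ, Set.ncard_image_of_injective _ hinj, Set.ncard_univ, hcard]
    · rintro c ⟨C, -, hC, hd, rfl⟩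
      rw [← hcard, ← Nat.card_coe_set_eq]
      have hk : ∀ X : C, finrank F (LinearMap.ker X.1.mulVecLin) = n - r := by
        intro X
        have h1 := rank_add_ker F X.1
        have h2 : X.1.rank = r := hC X.1 X.2
        omega
      refine Nat.card_le_card_of_injective
        (fun X : C => (⟨LinearMap.ker X.1.mulVecLin, hk X⟩ :
          {U : Submodule F (Fin n → F) // finrank F U = n - r})) ?_
      intro X Y h
      have hXY : LinearMap.ker X.1.mulVecLin = LinearMap.ker Y.1.mulVecLin :=
        congrArg Subtype.val h
      by_contra hne
      have h1 := hd X.1 X.2 Y.1 Y.2 (fun h => hne (Subtype.ext h))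
      have h2 := rank_add_ker F (X.1 - Y.1)
      have h3 : LinearMap.ker X.1.mulVecLin ≤ LinearMap.ker (X.1 - Y.1).mulVecLin := by
        intro v hv
        have hv' := hXY ▸ hv
        simp only [LinearMap.mem_ker, Matrix.mulVecLin_apply] at hv hv' ⊢
        rw [Matrix.sub_mulVec, hv, hv', sub_zero]
      have h4 := Submodule.finrank_mono h3
      rw [hk] at h4
      omega
  · have hcard := card_grass F (Fin n → F) r (by simpa using hrn.le)
    rw [Module.finrank_fin_fun] at hcard
    apply IsGreatest.csSup_eq
    constructor
    · refine ⟨{U | finrank F U = r}, ?_, fun U hU => hU, ?_, ?_⟩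
      · obtain ⟨U, hU⟩ := exists_sub F n r hrn.le
        exact ⟨U, hU⟩
      · intro U hU V hV hne
        simp only [Set.mem_ofPred_eq] at hU hV
        rw [injDist, hU, hV, min_self]
        by_contra hlt
        apply hne
        have h1 : U = U ⊔ V := Submodule.eq_of_le_of_finrank_le le_sup_left (by omega)
        have h2 : V = U ⊔ V := Submodule.eq_of_le_of_finrank_le le_sup_right (by omega)
        exact h1.trans h2.symm
      · rw [← hcard, ← Nat.card_coe_set_eq]
        rfl
    · rintro c ⟨S, -, hS, -, rfl⟩
      rw [← hcard, ← Nat.card_coe_set_eq]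
      exact Nat.card_le_card_of_injective
        (fun U : S => (⟨U.1, hS U.1 U.2⟩ : {U : Submodule F (Fin n → F) // finrank F U = r}))
        (fun X Y h => Subtype.ext (Subtype.mk.inj h))
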